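/- arXiv:2410.11606 — 2 statements merged into one kernel-verified Lean document; each statement's English description precedes it below -/
import Mathlib

section
/- Let A be a commutative Noetherian ring and M a nonzero finitely generated A-module with Ass(M) = {p_1, …, p_n}, where the p_i are pairwise distinct and the enumeration satisfies: p_i ⊊ p_j implies j < i. Then there exists a unique chain of submodules 0 = M_0 ⊆ M_1 ⊆ ⋯ ⊆ M_n = M such that Ass(M_i/M_{i-1}) = {p_i} for every i ∈ {1, …, n}. Moreover, M_{n-1} = ker(M → M_{p_n}), the kernel of the canonical localization map of M at p_n. -/
section CoprimaryFiltration

variable {A : Type*} [CommRing A] {M : Type*} [AddCommGroup M] [Module A M]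

/-- A finitely generated submodule that vanishes after localizing at `S` is annihilated by a
single element of `S`. -/
theorem Submodule.FG.exists_mem_forall_smul_eq_zero {S : Submonoid A} {N : Submodule A M}
    (hfg : N.FG) (hN : N ≤ LinearMap.ker (LocalizedModule.mkLinearMap S M)) :
    ∃ s ∈ S, ∀ x ∈ N, s • x = 0 := by
  induction N, hfg using Submodule.fg_induction with
  | singleton x =>
    obtain ⟨s, hs, hsx⟩ := LocalizedModule.mem_ker_mkLinearMap_iff.mp
      (hN (Submodule.mem_span_singleton_self x))
    refine ⟨s, hs, fun y hy => ?_⟩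
    obtain ⟨a, rfl⟩ := Submodule.mem_span_singleton.mp hy
    rw [smul_comm, hsx, smul_zero]
  | sup N₁ N₂ _ _ h₁ h₂ =>
    obtain ⟨s, hs, hs'⟩ := h₁ (le_sup_left.trans hN)
    obtain ⟨t, ht, ht'⟩ := h₂ (le_sup_right.trans hN)
    refine ⟨s * t, mul_mem hs ht, fun x hx => ?_⟩
    obtain ⟨y, hy, z, hz, rfl⟩ := Submodule.mem_sup.mp hx
    rw [smul_add, mul_smul, mul_smul, ht' z hz, smul_zero, smul_comm, hs' y hy, smul_zero,
      add_zero]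

/-- Associated primes of a subquotient `L / (L ∩ N)`, in terms of elements of `L`. -/
theorem mem_associatedPrimes_subquotient_iff [IsNoetherianRing A] {L N : Submodule A M}
    {I : Ideal A} :
    I ∈ associatedPrimes A (L ⧸ N.comap L.subtype) ↔
      I.IsPrime ∧ ∃ x ∈ L, ∀ a, a ∈ I ↔ a • x ∈ N := by
  rw [AssociatedPrimes.mem_iff, isAssociatedPrime_iff]
  refine and_congr_right fun _ => ?_
  rw [(Submodule.mkQ_surjective (N.comap L.subtype)).exists]
  simp [SetLike.ext_iff, Submodule.mem_colon_singleton, ← Submodule.Quotient.mk_smul]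

theorem mem_associatedPrimes_iff_exists_smul_eq_zero [IsNoetherianRing A] {I : Ideal A} :
    I ∈ associatedPrimes A M ↔ I.IsPrime ∧ ∃ x : M, ∀ a, a ∈ I ↔ a • x = 0 := by
  rw [AssociatedPrimes.mem_iff, isAssociatedPrime_iff]
  simp [SetLike.ext_iff, Submodule.mem_colon_singleton]

/-- If `q` is the only associated prime of `L / (L ∩ N)` and `q` is not contained in the prime `p`,
then some element outside `p` carries `L` into `N`. -/
theorem exists_notMem_forall_smul_mem_of_associatedPrimes_eq [IsNoetherianRing A]
    [Module.Finite A M] {L N : Submodule A M} {p q : Ideal A} [p.IsPrime]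
    (hq : associatedPrimes A (L ⧸ N.comap L.subtype) = {q}) (hqp : ¬ q ≤ p) :
    ∃ s ∉ p, ∀ x ∈ L, s • x ∈ N := by
  have hle : ¬ Module.annihilator A (L ⧸ N.comap L.subtype) ≤ p := fun h => by
    obtain ⟨r, hr, hrp⟩ := Ideal.exists_minimalPrimes_le h
    have := Module.associatedPrimes.minimalPrimes_annihilator_subset_associatedPrimes A _ hr
    rw [hq, Set.mem_singleton_iff] at this
    exact hqp (this ▸ hrp)
  obtain ⟨s, hs, hsp⟩ := SetLike.not_le_iff_exists.mp hle
  refine ⟨s, hsp, fun x hx => ?_⟩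
  have := Module.mem_annihilator.mp hs (Submodule.Quotient.mk ⟨x, hx⟩)
  simpa [← Submodule.Quotient.mk_smul] using this

/-- If `q` is the only associated prime of `L / (L ∩ N)`, then an element of `L` that is killed by
something outside `q` lies in `N`. -/
theorem mem_of_associatedPrimes_eq [IsNoetherianRing A] {L N : Submodule A M} {q : Ideal A}
    (hq : associatedPrimes A (L ⧸ N.comap L.subtype) = {q}) {x : M} (hx : x ∈ L) {s : A}
    (hs : s ∉ q) (hsx : s • x = 0) : x ∈ N := by
  by_contra hxN
  obtain ⟨P, hP, hle⟩ := exists_le_isAssociatedPrime_of_isNoetherianRing A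
    (Submodule.Quotient.mk ⟨x, hx⟩ : L ⧸ N.comap L.subtype) (by simpa using hxN)
  rw [← AssociatedPrimes.mem_iff, hq, Set.mem_singleton_iff] at hP
  subst hP
  refine hs (hle ?_)
  simp [Submodule.mem_colon_singleton, ← Submodule.Quotient.mk_smul, hsx]

/-- The elements of `M` that vanish in the localizations at all `p i` with `k ≤ i`. -/
noncomputable def tailLocalizationKernel (M : Type*) [AddCommGroup M] [Module A M] {n : ℕ}
    (p : Fin n → Ideal A) (hprime : ∀ i, (p i).IsPrime) (k : ℕ) : Submodule A M :=
  ⨅ (i : Fin n) (_ : k ≤ i),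
    LinearMap.ker (LocalizedModule.mkLinearMap (@Ideal.primeCompl A _ (p i) (hprime i)) M)

section

variable {n : ℕ} {p : Fin n → Ideal A} {hprime : ∀ i, (p i).IsPrime}

theorem mem_tailLocalizationKernel {k : ℕ} {x : M} :
    x ∈ tailLocalizationKernel M p hprime k ↔
      ∀ i : Fin n, k ≤ i → ∃ s ∉ p i, s • x = 0 := by
  simp only [tailLocalizationKernel, Submodule.mem_iInf, LocalizedModule.mem_ker_mkLinearMap_iff]
  rfl

theorem tailLocalizationKernel_mono : Monotone (tailLocalizationKernel M p hprime) :=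
  fun _ _ hkl _ hx => mem_tailLocalizationKernel.mpr fun i hi =>
    mem_tailLocalizationKernel.mp hx i (hkl.trans hi)

theorem tailLocalizationKernel_self : tailLocalizationKernel M p hprime n = ⊤ :=
  eq_top_iff.mpr fun _ _ => mem_tailLocalizationKernel.mpr fun i hi =>
    absurd i.isLt hi.not_gt

theorem tailLocalizationKernel_zero [IsNoetherianRing A]
    (hAss : associatedPrimes A M = Set.range p) : tailLocalizationKernel M p hprime 0 = ⊥ := by
  refine (Submodule.eq_bot_iff _).mpr fun x hx => ?_
  by_contra hx0
  obtain ⟨P, hP, hle⟩ := exists_le_isAssociatedPrime_of_isNoetherianRing A x hx0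
  rw [← AssociatedPrimes.mem_iff, hAss] at hP
  obtain ⟨i, rfl⟩ := hP
  obtain ⟨s, hs, hsx⟩ := mem_tailLocalizationKernel.mp hx i (Nat.zero_le _)
  exact hs (hle (by simpa [Submodule.mem_colon_singleton] using hsx))

theorem mem_tailLocalizationKernel_of_succ {i : Fin n} {x : M}
    (hx : x ∈ tailLocalizationKernel M p hprime (i + 1)) {s : A} (hs : s ∉ p i)
    (hsx : s • x ∈ tailLocalizationKernel M p hprime i) :
    x ∈ tailLocalizationKernel M p hprime i := by
  rw [mem_tailLocalizationKernel] at hx ⊢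
  intro j hj
  rcases hj.eq_or_lt with h | h
  · obtain rfl := Fin.ext h
    obtain ⟨t, ht, htx⟩ := mem_tailLocalizationKernel.mp hsx i le_rfl
    exact ⟨t * s, fun h => ((hprime i).mem_or_mem h).elim ht hs, by rw [mul_smul, htx]⟩
  · exact hx j h

theorem associatedPrimes_tailLocalizationKernel [IsNoetherianRing A] [Module.Finite A M]
    (hinj : Function.Injective p) (hAss : associatedPrimes A M = Set.range p)
    (horder : ∀ i j, p i < p j → j < i) (i : Fin n) :
    associatedPrimes A (tailLocalizationKernel M p hprime (i + 1) ⧸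
      (tailLocalizationKernel M p hprime i).comap
        (tailLocalizationKernel M p hprime (i + 1)).subtype) = {p i} := by
  ext Q
  rw [mem_associatedPrimes_subquotient_iff, Set.mem_singleton_iff]
  constructor
  · rintro ⟨hQ, x, hx, hQx⟩
    have hxi : x ∉ tailLocalizationKernel M p hprime i := fun h =>
      hQ.ne_top ((Ideal.eq_top_iff_one _).mpr ((hQx 1).mpr (by rwa [one_smul])))
    have hQi : Q ≤ p i := fun a ha => by
      by_contra hai
      exact hxi (mem_tailLocalizationKernel_of_succ hx hai ((hQx a).mp ha))
    obtain ⟨s, hs, hs0⟩ := (IsNoetherian.noetherian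
      (tailLocalizationKernel M p hprime i)).exists_mem_forall_smul_eq_zero
        (S := @Ideal.primeCompl A _ (p i) (hprime i)) (iInf₂_le i le_rfl)
    have hQM : Q ∈ associatedPrimes A M := by
      refine mem_associatedPrimes_iff_exists_smul_eq_zero.mpr ⟨hQ, s • x, fun a => ?_⟩
      refine ⟨fun ha => by rw [smul_comm, hs0 _ ((hQx a).mp ha)], fun ha => ?_⟩
      have : a * s ∈ Q := (hQx _).mpr (by rw [mul_smul, ha]; exact zero_mem _)
      exact (hQ.mem_or_mem this).resolve_right fun h => hs (hQi h)
    rw [hAss] at hQM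
    obtain ⟨j, rfl⟩ := hQM
    rcases hQi.eq_or_lt with h | h
    · exact h
    · obtain ⟨t, ht, htx⟩ := mem_tailLocalizationKernel.mp hx j (horder _ _ h)
      exact absurd ((hQx t).mpr (by rw [htx]; exact zero_mem _)) ht
  · rintro rfl
    obtain ⟨_, x, hx⟩ := mem_associatedPrimes_iff_exists_smul_eq_zero.mp
      (hAss ▸ Set.mem_range_self i : p i ∈ associatedPrimes A M)
    have hxi : x ∈ tailLocalizationKernel M p hprime (i + 1) := by
      refine mem_tailLocalizationKernel.mpr fun j hj => ?_
      have hij : ¬ p i ≤ p j := fun h => by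
        have hne : p i ≠ p j := fun h => (Fin.lt_def.mpr hj).ne (hinj h)
        exact (Fin.lt_def.mpr hj).asymm (horder i j (lt_of_le_of_ne h hne))
      obtain ⟨s, hs, hsj⟩ := SetLike.not_le_iff_exists.mp hij
      exact ⟨s, hsj, (hx s).mp hs⟩
    refine ⟨hprime i, x, hxi, fun a => ⟨fun ha => by rw [(hx a).mp ha]; exact zero_mem _, ?_⟩⟩
    intro ha
    obtain ⟨s, hs, hsa⟩ := mem_tailLocalizationKernel.mp ha i le_rfl
    rw [← mul_smul, ← hx] at hsa
    exact ((hprime i).mem_or_mem hsa).resolve_left hs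

theorem eq_tailLocalizationKernel [IsNoetherianRing A] [Module.Finite A M]
    (hinj : Function.Injective p) (horder : ∀ i j, p i < p j → j < i)
    {F : Fin (n + 1) → Submodule A M} (hbot : F 0 = ⊥) (htop : F (Fin.last n) = ⊤)
    (hF : ∀ i : Fin n,
      associatedPrimes A (F i.succ ⧸ (F i.castSucc).comap (F i.succ).subtype) = {p i})
    (k : Fin (n + 1)) : F k = tailLocalizationKernel M p hprime k := by
  apply le_antisymm
  · induction k using Fin.induction with
    | zero => simp [hbot]
    | succ i ih =>
      intro x hx
      refine mem_tailLocalizationKernel.mpr fun j hj => ?_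
      have hij : i < j := Fin.lt_def.mpr hj
      have hle : ¬ p i ≤ p j := fun h =>
        hij.asymm (horder i j (lt_of_le_of_ne h fun h => hij.ne (hinj h)))
      have := hprime j
      obtain ⟨s, hs, hsF⟩ := exists_notMem_forall_smul_mem_of_associatedPrimes_eq (hF i) hle
      obtain ⟨t, ht, htx⟩ := mem_tailLocalizationKernel.mp (ih (hsF x hx)) j (le_of_lt hij)
      exact ⟨t * s, fun h => ((hprime j).mem_or_mem h).elim ht hs, by rw [mul_smul, htx]⟩
  · induction k using Fin.reverseInduction with
    | last => simp [htop]
    | cast i ih =>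
      intro x hx
      obtain ⟨s, hs, hsx⟩ := mem_tailLocalizationKernel.mp hx i le_rfl
      exact mem_of_associatedPrimes_eq (hF i)
        (ih (tailLocalizationKernel_mono (Nat.le_succ _) hx)) hs hsx

end

end CoprimaryFiltration


/-- Let `A` be a commutative Noetherian ring and `M` a nonzero finitely
generated `A`-module with `Ass(M) = {p 0, …, p (n-1)}` (the `p i` pairwise distinct), the
enumeration satisfying `p i ⊊ p j → j < i`.  Then there is a unique chain of submodules
`0 = M₀ ⊆ M₁ ⊆ ⋯ ⊆ Mₙ = M` with `Ass(Mᵢ₊₁/Mᵢ) = {p i}` for all `i`; moreover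
`M_{n-1} = ker (M → M_{pₙ})` for the last prime `pₙ`. -/
theorem exists_unique_coprimary_filtration
    {A : Type*} [CommRing A] [IsNoetherianRing A]
    {M : Type*} [AddCommGroup M] [Module A M] [Module.Finite A M] [Nontrivial M]
    (n : ℕ) (p : Fin n → Ideal A) (hprime : ∀ i, (p i).IsPrime)
    (hinj : Function.Injective p)
    (hAss : associatedPrimes A M = Set.range p)
    (horder : ∀ i j, p i < p j → j < i) :
    (∃! F : Fin (n + 1) → Submodule A M,
      F 0 = ⊥ ∧ F (Fin.last n) = ⊤ ∧ Monotone F ∧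
      ∀ i : Fin n,
        associatedPrimes A
          (↥(F i.succ) ⧸ Submodule.comap (F i.succ).subtype (F i.castSucc)) = {p i}) ∧
    ∀ F : Fin (n + 1) → Submodule A M,
      (F 0 = ⊥ ∧ F (Fin.last n) = ⊤ ∧ Monotone F ∧
        ∀ i : Fin n,
          associatedPrimes A
            (↥(F i.succ) ⧸ Submodule.comap (F i.succ).subtype (F i.castSucc)) = {p i}) →
      ∀ i : Fin n, (i : ℕ) + 1 = n →
        F i.castSucc =
          LinearMap.ker
            (LocalizedModule.mkLinearMap (@Ideal.primeCompl A _ (p i) (hprime i)) M) := by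
  refine ⟨⟨fun k => tailLocalizationKernel M p hprime k, ⟨?_, ?_, ?_, ?_⟩, ?_⟩, ?_⟩
  · exact tailLocalizationKernel_zero hAss
  · exact tailLocalizationKernel_self
  · exact fun _ _ h => tailLocalizationKernel_mono h
  · exact associatedPrimes_tailLocalizationKernel hinj hAss horder
  · rintro F ⟨hbot, htop, -, hF⟩
    exact funext (eq_tailLocalizationKernel hinj horder hbot htop hF)
  · rintro F ⟨hbot, htop, -, hF⟩ i hi
    rw [eq_tailLocalizationKernel (hprime := hprime) hinj horder hbot htop hF]
    refine le_antisymm (iInf₂_le i le_rfl) (le_iInf₂ fun j hj => ?_)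
    obtain rfl : i = j := Fin.ext (le_antisymm hj (by omega))
    exact le_rfl
end

section
/- Let A be a Dedekind domain and M a nonzero finitely generated A-module. Then any two coprimary filtrations of M are equivalent: if 0 = M_0 ⊆ ⋯ ⊆ M_n = M is a coprimary filtration with respect to an enumeration p_1, …, p_n of Ass(M) and 0 = N_0 ⊆ ⋯ ⊆ N_n = M is a coprimary filtration with respect to an enumeration q_1, …, q_n of Ass(M), then M_i/M_{i-1} ≅ N_j/N_{j-1} as A-modules whenever p_i = q_j. -/
/-- A coprimary filtration of `M` with respect to the enumeration `p 0, …, p (n-1)` of its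
associated primes: a chain `0 = F 0 ⊆ F 1 ⊆ ⋯ ⊆ F n = M` with
`Ass(F (i+1) / F i) = {p i}` for each `i`. -/
def IsCoprimaryFiltration {A : Type*} [CommRing A] {M : Type*} [AddCommGroup M] [Module A M]
    {n : ℕ} (p : Fin n → Ideal A) (F : Fin (n + 1) → Submodule A M) : Prop :=
  F 0 = ⊥ ∧ F (Fin.last n) = ⊤ ∧ Monotone F ∧
  ∀ i : Fin n,
    associatedPrimes A
      (↥(F i.succ) ⧸ Submodule.comap (F i.succ).subtype (F i.castSucc)) = {p i}

/-- The submodule of elements killed by some power of the ideal `P`. -/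
def Submodule.powTorsion {A : Type*} [CommRing A] (M : Type*) [AddCommGroup M] [Module A M]
    (P : Ideal A) : Submodule A M where
  carrier := {x | ∃ k : ℕ, ∀ a ∈ P ^ k, a • x = 0}
  add_mem' := by
    rintro x y ⟨k, hk⟩ ⟨l, hl⟩
    refine ⟨k + l, fun a ha => ?_⟩
    rw [smul_add, hk a (Ideal.pow_le_pow_right (Nat.le_add_right k l) ha),
      hl a (Ideal.pow_le_pow_right (Nat.le_add_left l k) ha), add_zero]
  zero_mem' := ⟨0, fun a _ => smul_zero a⟩
  smul_mem' := by
    rintro c x ⟨k, hk⟩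
    exact ⟨k, fun a ha => by rw [smul_comm, hk a ha, smul_zero]⟩

theorem exists_pow_le_annihilator_of_associatedPrimes_eq_singleton {A : Type*} [CommRing A]
    [IsNoetherianRing A] {Q : Type*} [AddCommGroup Q] [Module A Q] [Module.Finite A Q]
    {P : Ideal A} (h : associatedPrimes A Q = {P}) :
    ∃ k : ℕ, P ^ k ≤ Module.annihilator A Q := by
  have hP : P ≤ (Module.annihilator A Q).radical := by
    rw [← Ideal.sInf_minimalPrimes]
    refine le_sInf fun I hI => ?_
    have hmem := Module.associatedPrimes.minimalPrimes_annihilator_subset_associatedPrimes A Q hI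
    rw [h] at hmem
    exact (Set.mem_singleton_iff.mp hmem).ge
  exact Ideal.exists_pow_le_of_le_radical_of_fg hP (IsNoetherian.noetherian P)

namespace IsCoprimaryFiltration

section Noetherian

variable {A : Type*} [CommRing A] [IsNoetherianRing A] {M : Type*} [AddCommGroup M] [Module A M]
  {n : ℕ} {p : Fin n → Ideal A} {F : Fin (n + 1) → Submodule A M}

theorem mem_castSucc_of_smul_mem (hF : IsCoprimaryFiltration p F) {k : Fin n} {a : A} {x : M}
    (ha : a ∉ p k) (hx : x ∈ F k.succ) (hax : a • x ∈ F k.castSucc) : x ∈ F k.castSucc := by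
  by_contra hxk
  have hzero := biUnion_associatedPrimes_eq_zero_divisors A
    (↥(F k.succ) ⧸ Submodule.comap (F k.succ).subtype (F k.castSucc))
  rw [hF.2.2.2 k, Set.biUnion_singleton] at hzero
  refine ha ((Set.ext_iff.mp hzero a).mpr
    ⟨Submodule.Quotient.mk ⟨x, hx⟩, fun h => hxk ?_, ?_⟩)
  · simpa using (Submodule.Quotient.mk_eq_zero _).mp h
  · rw [← Submodule.Quotient.mk_smul, Submodule.Quotient.mk_eq_zero]
    simpa using hax

/-- Membership descends from `F v` to `F u` for an element killed by scalars that avoid each of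
the primes occurring between `u` and `v`. -/
theorem mem_of_forall_exists_smul_eq_zero (hF : IsCoprimaryFiltration p F) {x : M}
    (u v : Fin (n + 1)) (hx : x ∈ F v)
    (h : ∀ k : Fin n, u ≤ k.castSucc → k.succ ≤ v → ∃ a ∉ p k, a • x = 0) : x ∈ F u := by
  induction v using Fin.induction with
  | zero => exact hF.2.2.1 (Fin.zero_le u) hx
  | succ k ih =>
    rcases le_or_gt k.succ u with hu | hu
    · exact hF.2.2.1 hu hx
    · have huk : u ≤ k.castSucc := Fin.le_castSucc_iff.mpr hu
      obtain ⟨a, ha, hax⟩ := h k huk le_rfl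
      exact ih (hF.mem_castSucc_of_smul_mem ha hx (hax ▸ zero_mem _))
        fun l hl hlk => h l hl (hlk.trans k.castSucc_lt_succ.le)

variable [Module.Finite A M]

theorem exists_pow_smul_mem (hF : IsCoprimaryFiltration p F) (k : Fin n) :
    ∃ m : ℕ, ∀ a ∈ p k ^ m, ∀ x ∈ F k.succ, a • x ∈ F k.castSucc := by
  obtain ⟨m, hm⟩ := exists_pow_le_annihilator_of_associatedPrimes_eq_singleton (hF.2.2.2 k)
  refine ⟨m, fun a ha x hx => ?_⟩
  have hax := Module.mem_annihilator.mp (hm ha) (Submodule.Quotient.mk ⟨x, hx⟩)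
  rw [← Submodule.Quotient.mk_smul, Submodule.Quotient.mk_eq_zero] at hax
  simpa using hax

theorem exists_ideal_smul_eq_zero (hF : IsCoprimaryFiltration p F) (P : Ideal A) [P.IsPrime]
    (v : Fin (n + 1)) (h : ∀ k : Fin n, k.succ ≤ v → ¬ p k ≤ P) :
    ∃ J : Ideal A, ¬ J ≤ P ∧ ∀ a ∈ J, ∀ x ∈ F v, a • x = 0 := by
  induction v using Fin.induction with
  | zero =>
    refine ⟨⊤, fun hP => Ideal.IsPrime.ne_top ‹_› (top_le_iff.mp hP), fun a _ x hx => ?_⟩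
    rw [hF.1, Submodule.mem_bot] at hx
    rw [hx, smul_zero]
  | succ k ih =>
    obtain ⟨J, hJP, hJ⟩ := ih fun l hl => h l (hl.trans k.castSucc_lt_succ.le)
    obtain ⟨m, hm⟩ := hF.exists_pow_smul_mem k
    refine ⟨J * p k ^ m, fun hle => ?_, fun a ha x hx => ?_⟩
    · rcases (Ideal.IsPrime.mul_le ‹_›).mp hle with hle | hle
      · exact hJP hle
      · exact h k le_rfl (Ideal.IsPrime.le_of_pow_le hle)
    · induction ha using Submodule.mul_induction_on' with
      | mem_mul_mem b hb c hc => rw [mul_smul]; exact hJ b hb _ (hm c hc x hx)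
      | add b _ c _ hb hc => rw [add_smul, hb, hc, add_zero]

theorem exists_ideal_smul_castSucc_eq_zero (hF : IsCoprimaryFiltration p F)
    (hp : Function.Injective p) (hporder : ∀ a b, p a < p b → b < a) (i : Fin n)
    [(p i).IsPrime] :
    ∃ J : Ideal A, ¬ J ≤ p i ∧ ∀ a ∈ J, ∀ x ∈ F i.castSucc, a • x = 0 := by
  refine hF.exists_ideal_smul_eq_zero (p i) i.castSucc fun k hk hle => ?_
  have hki : k < i := Fin.succ_le_castSucc_iff.mp hk
  exact (hporder k i (lt_of_le_of_ne hle (hp.ne hki.ne))).asymm hki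

/-- The factor of a coprimary filtration at a maximal ideal `P` is the `P`-power torsion. -/
theorem nonempty_powTorsion_equiv (hF : IsCoprimaryFiltration p F)
    (hp : Function.Injective p) (hprime : ∀ k, (p k).IsPrime)
    (hporder : ∀ a b, p a < p b → b < a) (i : Fin n) (hi : (p i).IsMaximal) :
    Nonempty (Submodule.powTorsion M (p i) ≃ₗ[A]
      (↥(F i.succ) ⧸ Submodule.comap (F i.succ).subtype (F i.castSucc))) := by
  have hkill : ∀ x ∈ Submodule.powTorsion M (p i), ∀ k, k ≠ i → ∃ a ∉ p k, a • x = 0 := by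
    rintro x ⟨m, hm⟩ k hk
    have hnot : ¬ p i ^ m ≤ p k := fun hle =>
      hk (hp (hi.eq_of_le (hprime k).ne_top ((hprime k).le_of_pow_le hle)).symm)
    obtain ⟨a, ha, hak⟩ := SetLike.not_le_iff_exists.mp hnot
    exact ⟨a, hak, hm a ha⟩
  have hle : Submodule.powTorsion M (p i) ≤ F i.succ := fun x hx =>
    hF.mem_of_forall_exists_smul_eq_zero i.succ (Fin.last n) (by rw [hF.2.1]; trivial)
      fun k hk _ => hkill x hx k (Fin.succ_le_castSucc_iff.mp hk).ne'
  refine ⟨LinearEquiv.ofBijective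
    ((Submodule.mkQ _).comp (Submodule.inclusion hle)) ⟨?_, fun y => ?_⟩⟩
  · rw [injective_iff_map_eq_zero]
    rintro ⟨x, hx⟩ hx0
    have hxi : x ∈ F i.castSucc := by
      simpa using (Submodule.Quotient.mk_eq_zero _).mp hx0
    have hbot := hF.mem_of_forall_exists_smul_eq_zero 0 i.castSucc hxi
      fun k _ hk => hkill x hx k (Fin.succ_le_castSucc_iff.mp hk).ne
    rw [hF.1, Submodule.mem_bot] at hbot
    exact Subtype.ext hbot
  · obtain ⟨⟨x, hx⟩, rfl⟩ := Submodule.Quotient.mk_surjective _ y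
    obtain ⟨m, hm⟩ := hF.exists_pow_smul_mem i
    obtain ⟨J, hJP, hJ⟩ := hF.exists_ideal_smul_castSucc_eq_zero hp hporder i
    have hcop : IsCoprime (p i ^ m) J :=
      (Ideal.isCoprime_iff_sup_eq.mpr (hi.out.2 _ (left_lt_sup.mpr hJP))).pow_left
    obtain ⟨a, ha, b, hb, hab⟩ := Ideal.isCoprime_iff_exists.mp hcop
    refine ⟨⟨b • x, m, fun c hc => ?_⟩, ?_⟩
    · rw [smul_comm]
      exact hJ b hb _ (hm c hc x hx)
    · refine (Submodule.Quotient.eq _).mpr ?_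
      have hsub : b • x - x = -(a • x) := by
        rw [sub_eq_iff_eq_add, eq_neg_add_iff_add_eq, ← add_smul, hab, one_smul]
      have hmem : b • x - x ∈ F i.castSucc := hsub ▸ neg_mem (hm a ha x hx)
      simpa using hmem

end Noetherian

section Domain

variable {A : Type*} [CommRing A] {M : Type*} [AddCommGroup M] [Module A M]
  {n : ℕ} {p : Fin n → Ideal A} {F : Fin (n + 1) → Submodule A M}

theorem succ_eq_top_of_eq_bot (hF : IsCoprimaryFiltration p F) (hp : Function.Injective p)
    (hporder : ∀ a b, p a < p b → b < a) {i : Fin n} (hi : p i = ⊥) : F i.succ = ⊤ := by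
  have hlast : i.succ = Fin.last n := by
    refine le_antisymm (Fin.le_last _) (not_lt.mp fun hlt => ?_)
    have hin : (i : ℕ) + 1 < n := by simpa [Fin.lt_def] using hlt
    have hne : p i ≠ p ⟨i + 1, hin⟩ := hp.ne (by simp [Fin.ext_iff])
    have := hporder i ⟨i + 1, hin⟩ (lt_of_le_of_ne (hi ▸ bot_le) hne)
    simp [Fin.lt_def] at this
  rw [hlast, hF.2.1]

theorem castSucc_eq_torsion_of_eq_bot [IsDomain A] [IsNoetherianRing A] [Module.Finite A M]
    (hF : IsCoprimaryFiltration p F) (hp : Function.Injective p)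
    (hporder : ∀ a b, p a < p b → b < a) {i : Fin n} (hi : p i = ⊥) :
    F i.castSucc = Submodule.torsion A M := by
  refine le_antisymm (fun x hx => ?_) fun x hx => ?_
  · have : (p i).IsPrime := hi ▸ Ideal.isPrime_bot
    obtain ⟨J, hJP, hJ⟩ := hF.exists_ideal_smul_castSucc_eq_zero hp hporder i
    obtain ⟨a, ha, hai⟩ := SetLike.not_le_iff_exists.mp hJP
    rw [hi, Ideal.mem_bot] at hai
    exact (Submodule.mem_torsion_iff x).mpr ⟨⟨a, mem_nonZeroDivisors_of_ne_zero hai⟩, hJ a ha x hx⟩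
  · obtain ⟨a, hax⟩ := (Submodule.mem_torsion_iff x).mp hx
    refine hF.mem_castSucc_of_smul_mem (a := (a : A)) ?_ ?_ ?_
    · rw [hi, Ideal.mem_bot]
      exact nonZeroDivisors.coe_ne_zero a
    · rw [hF.succ_eq_top_of_eq_bot hp hporder hi]
      trivial
    · have hzero : (a : A) • x = 0 := hax
      exact hzero ▸ zero_mem _

end Domain

end IsCoprimaryFiltration

/-- Let `A` be a Dedekind domain and `M` a nonzero finitely generated
`A`-module.  Then any two coprimary filtrations of `M` are equivalent: subquotients
associated to the same prime are isomorphic. -/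
theorem coprimary_filtrations_equivalent_of_isDedekindDomain
    {A : Type*} [CommRing A] [IsDedekindDomain A]
    {M : Type*} [AddCommGroup M] [Module A M] [Module.Finite A M] [Nontrivial M]
    {n : ℕ} (p q : Fin n → Ideal A)
    (hpinj : Function.Injective p) (hpAss : associatedPrimes A M = Set.range p)
    (hporder : ∀ a b, p a < p b → b < a)
    (hqinj : Function.Injective q) (hqAss : associatedPrimes A M = Set.range q)
    (hqorder : ∀ a b, q a < q b → b < a)
    (F G : Fin (n + 1) → Submodule A M)
    (hF : IsCoprimaryFiltration p F) (hG : IsCoprimaryFiltration q G)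
    (i j : Fin n) (hij : p i = q j) :
    Nonempty ((↥(F i.succ) ⧸ Submodule.comap (F i.succ).subtype (F i.castSucc)) ≃ₗ[A]
      (↥(G j.succ) ⧸ Submodule.comap (G j.succ).subtype (G j.castSucc))) := by
  have hpprime : ∀ k, (p k).IsPrime := fun k =>
    IsAssociatedPrime.isPrime (hpAss ▸ Set.mem_range_self k : p k ∈ associatedPrimes A M)
  have hqprime : ∀ k, (q k).IsPrime := fun k =>
    IsAssociatedPrime.isPrime (hqAss ▸ Set.mem_range_self k : q k ∈ associatedPrimes A M)
  by_cases hi : p i = ⊥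
  · have hj : q j = ⊥ := hij ▸ hi
    rw [hF.succ_eq_top_of_eq_bot hpinj hporder hi, hG.succ_eq_top_of_eq_bot hqinj hqorder hj,
      hF.castSucc_eq_torsion_of_eq_bot hpinj hporder hi,
      hG.castSucc_eq_torsion_of_eq_bot hqinj hqorder hj]
    exact ⟨LinearEquiv.refl A _⟩
  · have hmax : (p i).IsMaximal := (hpprime i).isMaximal hi
    obtain ⟨e⟩ := hF.nonempty_powTorsion_equiv hpinj hpprime hporder i hmax
    obtain ⟨f⟩ := hG.nonempty_powTorsion_equiv hqinj hqprime hqorder j (hij ▸ hmax)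
    exact ⟨e.symm.trans ((LinearEquiv.ofEq _ _ (congrArg _ hij)).trans f)⟩
end
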